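/- arXiv:2312.01329 — 7 statements merged into one kernel-verified Lean document; each statement's English description precedes it below -/
import Mathlib

section
/- Let k be a positive integer and C₁, C₂ > 0 real constants. For every (x₁,x₂) ∈ ℝ², with s = e^{2x₁}, t = e^{2x₂} and D = 1+s^k+t, the symmetric 2×2 matrix with entries g¹¹ = 4C₁·s/(1+s)² + 4C₂·k²(1+t)s^k/D², g¹² = g²¹ = −4C₂·k s^k t/D², g²² = 4C₂·(1+s^k)t/D² is positive definite. Equivalently, the function ψ(x₁,x₂) = C₂·log(1+e^{2k x₁}+e^{2x₂}) + C₁·log(1+e^{2x₁}) is strictly convex on ℝ². -/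
/-- Log-sum-exp is strictly convex along any segment whose direction is not a constant vector. -/
theorem log_sum_exp_lt {ι : Type*} [Fintype ι] (u v : ι → ℝ) {i j : ι}
    (hij : u i - v i ≠ u j - v j) {a b : ℝ} (ha : 0 < a) (hb : 0 < b) (hab : a + b = 1) :
    Real.log (∑ l, Real.exp (a * u l + b * v l)) <
      a * Real.log (∑ l, Real.exp (u l)) + b * Real.log (∑ l, Real.exp (v l)) := by
  have : Nonempty ι := ⟨i⟩
  have sum_pos (w : ι → ℝ) : 0 < ∑ l, Real.exp (w l) :=
    Finset.sum_pos (fun l _ => Real.exp_pos _) Finset.univ_nonempty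
  have sum_normalized (w : ι → ℝ) :
      ∑ l, Real.exp (w l - Real.log (∑ m, Real.exp (w m))) = 1 := by
    simp_rw [Real.exp_sub, ← Finset.sum_div, Real.exp_log (sum_pos w)]
    exact div_self (sum_pos w).ne'
  set U := Real.log (∑ l, Real.exp (u l))
  set V := Real.log (∑ l, Real.exp (v l))
  have hne : ∃ l, u l - U ≠ v l - V := by
    by_contra! h
    exact hij (by linarith [h i, h j])
  obtain ⟨m, hm⟩ := hne
  have key : ∑ l, Real.exp (a * (u l - U) + b * (v l - V)) <
      ∑ l, (a * Real.exp (u l - U) + b * Real.exp (v l - V)) := by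
    refine Finset.sum_lt_sum (fun l _ => ?_) ⟨m, Finset.mem_univ m, ?_⟩
    · simpa using convexOn_exp.2 (Set.mem_univ (u l - U)) (Set.mem_univ (v l - V)) ha.le hb.le hab
    · simpa using strictConvexOn_exp.2 (Set.mem_univ _) (Set.mem_univ _) hm ha hb hab
  rw [Finset.sum_add_distrib, ← Finset.mul_sum, ← Finset.mul_sum, sum_normalized u,
    sum_normalized v, mul_one, mul_one, hab] at key
  have split (l : ι) : a * (u l - U) + b * (v l - V) = a * u l + b * v l - (a * U + b * V) := by
    ring
  simp_rw [split, Real.exp_sub, ← Finset.sum_div] at key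
  rw [div_lt_one (Real.exp_pos _)] at key
  exact (Real.log_lt_iff_lt_exp (sum_pos _)).2 key

/-- The two-variable potential `log (1 + exp (c x) + exp (d y))` is strictly convex. -/
theorem strictConvexOn_log_one_add_exp_add_exp {c d : ℝ} (hc : c ≠ 0) (hd : d ≠ 0) :
    StrictConvexOn ℝ Set.univ
      (fun x : ℝ × ℝ => Real.log (1 + Real.exp (c * x.1) + Real.exp (d * x.2))) := by
  refine ⟨convex_univ, fun x _ y _ hxy a b ha hb hab => ?_⟩
  have hij : ∃ j : Fin 3, ![0, c * x.1, d * x.2] 0 - ![0, c * y.1, d * y.2] 0 ≠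
      ![0, c * x.1, d * x.2] j - ![0, c * y.1, d * y.2] j := by
    by_contra! h
    have h1 := h 1
    have h2 := h 2
    simp [eq_comm, sub_eq_zero, hc] at h1
    simp [eq_comm, sub_eq_zero, hd] at h2
    exact hxy (Prod.ext (by simp [h1]) (by simp [h2]))
  obtain ⟨j, hj⟩ := hij
  have := log_sum_exp_lt _ _ hj ha hb hab
  simp only [Fin.sum_univ_three, Matrix.cons_val, mul_zero, add_zero, Real.exp_zero] at this
  have lin (e p q : ℝ) : e * (a * p + b * q) = a * (e * p) + b * (e * q) := by ring
  simpa only [Prod.fst_add, Prod.snd_add, Prod.smul_fst, Prod.smul_snd, smul_eq_mul, lin] using this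

theorem convexOn_log_one_add_exp (c : ℝ) :
    ConvexOn ℝ Set.univ (fun x : ℝ => Real.log (1 + Real.exp (c * x))) := by
  refine convexOn_iff_forall_pos.2 ⟨convex_univ, fun x _ y _ a b ha hb hab => ?_⟩
  by_cases hxy : c * x = c * y
  · have : c * (a • x + b • y) = c * y := by
      simp only [smul_eq_mul]
      linear_combination a * hxy + c * y * hab
    simp only [this, hxy]
    rw [← add_smul, hab, one_smul]
  · have hij : ![0, c * x] 0 - ![0, c * y] 0 ≠ ![0, c * x] 1 - ![0, c * y] 1 := by
      simpa [eq_comm, sub_eq_zero] using hxy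
    have := log_sum_exp_lt _ _ hij ha hb hab
    simp only [Fin.sum_univ_two, Matrix.cons_val, mul_zero, add_zero, Real.exp_zero] at this
    have lin : c * (a * x + b * y) = a * (c * x) + b * (c * y) := by ring
    simpa only [smul_eq_mul, lin] using this.le

/-- A `2 × 2` matrix whose quadratic form is `A x² + B (P (k x)² + t y² + P t (k x - y)²)`. -/
theorem posDef_of_sum_sq {A B P t : ℝ} (k : ℝ) (hA : 0 < A) (hB : 0 < B) (hP : 0 < P)
    (ht : 0 < t) :
    (Matrix.of ![![A + B * (k ^ 2 * (1 + t) * P), -(B * (k * P * t))],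
      ![-(B * (k * P * t)), B * ((1 + P) * t)]]).PosDef := by
  refine Matrix.PosDef.of_dotProduct_mulVec_pos ?_ fun x hx => ?_
  · ext i j
    fin_cases i <;> fin_cases j <;> simp
  · have hform : A * x 0 ^ 2 + B * (P * (k * x 0) ^ 2 + t * x 1 ^ 2 +
        P * t * (k * x 0 - x 1) ^ 2) > 0 := by
      by_cases h0 : x 0 = 0
      · have h1 : x 1 ≠ 0 := fun h1 => hx (by ext i; fin_cases i <;> simp [h0, h1])
        positivity
      · positivity
    refine hform.trans_eq ?_
    simp [Matrix.mulVec, dotProduct, Fin.sum_univ_two]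
    ring

/-- the inverse-metric matrix {g^{ij}} of the Hirzebruch potential is
positive definite at every point; equivalently ψ is strictly convex on ℝ². -/
theorem stmt_2 (k : ℕ) (hk : 0 < k) (C₁ C₂ : ℝ) (hC₁ : 0 < C₁) (hC₂ : 0 < C₂) :
    (∀ x₁ x₂ : ℝ,
      Matrix.PosDef
        (Matrix.of
          ![![4 * C₁ * Real.exp (2 * x₁) / (1 + Real.exp (2 * x₁)) ^ 2
              + 4 * C₂ * k ^ 2 * (1 + Real.exp (2 * x₂)) * Real.exp (2 * x₁) ^ k
                / (1 + Real.exp (2 * x₁) ^ k + Real.exp (2 * x₂)) ^ 2,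
            -(4 * C₂ * k * Real.exp (2 * x₁) ^ k * Real.exp (2 * x₂))
                / (1 + Real.exp (2 * x₁) ^ k + Real.exp (2 * x₂)) ^ 2],
          ![-(4 * C₂ * k * Real.exp (2 * x₁) ^ k * Real.exp (2 * x₂))
                / (1 + Real.exp (2 * x₁) ^ k + Real.exp (2 * x₂)) ^ 2,
            4 * C₂ * (1 + Real.exp (2 * x₁) ^ k) * Real.exp (2 * x₂)
                / (1 + Real.exp (2 * x₁) ^ k + Real.exp (2 * x₂)) ^ 2]]))
    ∧ StrictConvexOn ℝ Set.univ
        (fun x : ℝ × ℝ =>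
          C₂ * Real.log (1 + Real.exp (2 * k * x.1) + Real.exp (2 * x.2))
            + C₁ * Real.log (1 + Real.exp (2 * x.1))) := by
  refine ⟨fun x₁ x₂ => ?_, ?_⟩
  · have hs := Real.exp_pos (2 * x₁)
    have ht := Real.exp_pos (2 * x₂)
    set s := Real.exp (2 * x₁)
    set t := Real.exp (2 * x₂)
    have hA : 0 < 4 * C₁ * s / (1 + s) ^ 2 := by positivity
    have hB : 0 < 4 * C₂ / (1 + s ^ k + t) ^ 2 := by positivity
    convert posDef_of_sum_sq (k : ℝ) hA hB (pow_pos hs k) ht using 5 <;> ring_nf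
  · have hk' : (2 * k : ℝ) ≠ 0 := by positivity
    have h₁ := strictConvexOn_log_one_add_exp_add_exp hk' two_ne_zero
    have h₂ := convexOn_log_one_add_exp 2
    refine ⟨convex_univ, fun x hx y hy hxy a b ha hb hab => ?_⟩
    have e₁ := mul_lt_mul_of_pos_left (h₁.2 hx hy hxy ha hb hab) hC₂
    have e₂ := mul_le_mul_of_nonneg_left
      (h₂.2 (Set.mem_univ x.1) (Set.mem_univ y.1) ha.le hb.le hab) hC₁.le
    simp only [smul_eq_mul, Prod.fst_add, Prod.snd_add, Prod.smul_fst, Prod.smul_snd] at e₁ e₂ ⊢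
    linarith
end

section
/- Let k be a positive integer. Define Φ : ℝ² → ℝ² by Φ(x₁,x₂) = ( 2e^{2x₁}/(1+e^{2x₁}) + 2k·e^{2k x₁}/(1+e^{2k x₁}+e^{2x₂}), 2e^{2x₂}/(1+e^{2k x₁}+e^{2x₂}) ). Then Φ is a bijection from ℝ² onto the open trapezoid B = { (x¹,x²) ∈ ℝ² : 0 < x² < 2 and 0 < x¹ < 2(1+k) − k·x² }. -/
open Filter Topology in
/-- A combination of logistic functions takes every value between its limits at `±∞`. -/
theorem exists_sigmoid_combination_eq {a b c d y : ℝ} (hc : 0 < c) (hd : 0 < d)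
    (hy : 0 < y) (hy' : y < a + b) :
    ∃ t, a * Real.sigmoid (c * t) + b * Real.sigmoid (d * t) = y := by
  have hcont : Continuous fun t => a * Real.sigmoid (c * t) + b * Real.sigmoid (d * t) := by
    fun_prop
  have hbot : Tendsto (fun t => a * Real.sigmoid (c * t) + b * Real.sigmoid (d * t))
      atBot (𝓝 0) := by
    simpa using
      ((Real.tendsto_sigmoid_atBot.comp (tendsto_id.const_mul_atBot hc)).const_mul a).add
        ((Real.tendsto_sigmoid_atBot.comp (tendsto_id.const_mul_atBot hd)).const_mul b)
  have htop : Tendsto (fun t => a * Real.sigmoid (c * t) + b * Real.sigmoid (d * t))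
      atTop (𝓝 (a + b)) := by
    simpa using
      ((Real.tendsto_sigmoid_atTop.comp (tendsto_id.const_mul_atTop hc)).const_mul a).add
        ((Real.tendsto_sigmoid_atTop.comp (tendsto_id.const_mul_atTop hd)).const_mul b)
  exact mem_range_of_exists_le_of_exists_ge hcont
    ((hbot.eventually_lt_const hy).exists.imp fun _ h => h.le)
    ((htop.eventually_const_lt hy').exists.imp fun _ h => h.le)

theorem strictMono_sigmoid_combination {a b c d : ℝ} (ha : 0 < a) (hb : 0 < b)
    (hc : 0 < c) (hd : 0 < d) :
    StrictMono fun t => a * Real.sigmoid (c * t) + b * Real.sigmoid (d * t) := by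
  intro s t hst
  have h₁ := Real.sigmoid_strictMono (mul_lt_mul_of_pos_left hst hc)
  have h₂ := Real.sigmoid_strictMono (mul_lt_mul_of_pos_left hst hd)
  exact add_lt_add (mul_lt_mul_of_pos_left h₁ ha) (mul_lt_mul_of_pos_left h₂ hb)

theorem exp_div_one_add_exp (t : ℝ) : Real.exp t / (1 + Real.exp t) = Real.sigmoid t := by
  rw [Real.sigmoid_def, Real.exp_neg]
  field_simp
  ring

/-- The first component of the gradient map as a function of `x₁` and of the second component. -/
theorem gradient_fst_eq (k s t w : ℝ) :
    2 * Real.exp (2 * s) / (1 + Real.exp (2 * s))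
        + 2 * k * Real.exp t / (1 + Real.exp t + Real.exp w) =
      2 * Real.sigmoid (2 * s)
        + k * (2 - 2 * Real.exp w / (1 + Real.exp t + Real.exp w)) * Real.sigmoid t := by
  rw [← exp_div_one_add_exp, ← exp_div_one_add_exp]
  have := Real.exp_pos s
  have := Real.exp_pos t
  have := Real.exp_pos w
  field_simp
  ring


/-- the map Φ (gradient of the potential, C₁ = C₂ = 1) is a bijection
from ℝ² onto the interior of the moment polytope of 𝔽_k. -/
theorem stmt_4 (k : ℕ) (hk : 0 < k) :
    Set.BijOn
      (fun x : ℝ × ℝ =>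
        ((2 * Real.exp (2 * x.1) / (1 + Real.exp (2 * x.1))
            + 2 * k * Real.exp (2 * k * x.1)
              / (1 + Real.exp (2 * k * x.1) + Real.exp (2 * x.2)),
          2 * Real.exp (2 * x.2)
              / (1 + Real.exp (2 * k * x.1) + Real.exp (2 * x.2))) : ℝ × ℝ))
      Set.univ
      {x : ℝ × ℝ | 0 < x.2 ∧ x.2 < 2 ∧ 0 < x.1 ∧ x.1 < 2 * (1 + k) - k * x.2} := by
  have hk' : (0 : ℝ) < k := by exact_mod_cast hk
  have h2k : (0 : ℝ) < 2 * k := by positivity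
  simp only [gradient_fst_eq]
  have hsnd (v w : ℝ) : 0 < 2 * Real.exp w / (1 + Real.exp v + Real.exp w) ∧
      2 * Real.exp w / (1 + Real.exp v + Real.exp w) < 2 := by
    refine ⟨by positivity, ?_⟩
    rw [div_lt_iff₀ (by positivity)]
    linarith [Real.exp_pos v]
  refine ⟨?_, ?_, ?_⟩
  · rintro ⟨s, t⟩ -
    obtain ⟨h₀, h₂⟩ := hsnd (2 * k * s) (2 * t)
    have hb := mul_pos hk' (sub_pos.2 h₂)
    refine ⟨h₀, h₂, ?_, ?_⟩
    · exact add_pos (mul_pos two_pos (Real.sigmoid_pos _)) (mul_pos hb (Real.sigmoid_pos _))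
    · have h₁ := mul_lt_mul_of_pos_left (Real.sigmoid_lt_one (2 * k * s)) hb
      have h₃ := Real.sigmoid_lt_one (2 * s)
      dsimp only
      linarith
  · rintro ⟨s, t⟩ - ⟨s', t'⟩ - h
    obtain ⟨h₁, h₂⟩ := Prod.mk.inj h
    dsimp only at h₁ h₂
    rw [← h₂] at h₁
    obtain rfl : s = s' := (strictMono_sigmoid_combination two_pos
      (mul_pos hk' (sub_pos.2 (hsnd (2 * k * s) (2 * t)).2)) two_pos h2k).injective h₁
    rw [div_eq_div_iff (by positivity) (by positivity)] at h₂
    have h₃ : Real.exp (2 * t) = Real.exp (2 * t') :=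
      mul_right_cancel₀ (b := 1 + Real.exp (2 * k * s)) (by positivity) (by linarith)
    rw [Prod.mk.injEq]
    exact ⟨rfl, by linarith [Real.exp_injective h₃]⟩
  · rintro ⟨y, z⟩ ⟨hz, hz', hy, hy'⟩
    dsimp only at hz hz' hy hy'
    obtain ⟨s, hs⟩ := exists_sigmoid_combination_eq (a := 2) (b := k * (2 - z)) two_pos h2k hy
      (by linarith)
    have hz₂ : 0 < 2 - z := sub_pos.2 hz'
    have hw : 0 < z * (1 + Real.exp (2 * k * s)) / (2 - z) := by positivity
    have hexp : 2 * Real.exp (2 * (Real.log (z * (1 + Real.exp (2 * k * s)) / (2 - z)) / 2)) /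
        (1 + Real.exp (2 * k * s) +
          Real.exp (2 * (Real.log (z * (1 + Real.exp (2 * k * s)) / (2 - z)) / 2))) = z := by
      rw [mul_div_cancel₀ _ two_ne_zero, Real.exp_log hw, div_eq_iff (by positivity)]
      field_simp
      ring
    refine ⟨(s, Real.log (z * (1 + Real.exp (2 * k * s)) / (2 - z)) / 2), trivial, ?_⟩
    simp only [hexp, hs]
end

section
/- Let k be a positive integer, and let a, b, i₁, i₂ be integers with a ≥ 0, b ≥ 1, 0 < i₂ < b and 0 < i₁ < a + k(b−i₂). Then the system of equations i₁ = a·s/(1+s) + b·k·s^k/(1+s^k+t), i₂ = b·t/(1+s^k+t) has a unique solution (s,t) ∈ (0,∞)²; moreover this solution satisfies t = (1+s^k)·i₂/(b−i₂), where s is the unique positive solution of i₁ = a·s/(1+s) + k(b−i₂)·s^k/(1+s^k). -/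
theorem strictMonoOn_div_one_add : StrictMonoOn (fun x : ℝ => x / (1 + x)) (Set.Ici 0) := by
  intro x hx y hy hxy
  simp only [Set.mem_Ici] at hx hy
  show x / (1 + x) < y / (1 + y)
  rw [div_lt_div_iff₀ (by positivity) (by positivity)]
  linarith

/-- A nonnegative combination of `s / (1 + s)` and `s ^ k / (1 + s ^ k)` attains every value
strictly between `0` and its supremum exactly once on the positive half-line. -/
theorem existsUnique_pos_eq_add_div_one_add {k : ℕ} (hk : 0 < k) {A C m : ℝ} (hA : 0 ≤ A)
    (hC : 0 < C) (hm : 0 < m) (hmAC : m < A + C) :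
    ∃! s : ℝ, 0 < s ∧ m = A * s / (1 + s) + C * s ^ k / (1 + s ^ k) := by
  set f : ℝ → ℝ := fun s => A * s / (1 + s) + C * s ^ k / (1 + s ^ k) with hf
  have hmono : StrictMonoOn f (Set.Ici 0) := by
    intro x hx y hy hxy
    have h₁ := strictMonoOn_div_one_add hx hy hxy
    have h₂ := strictMonoOn_div_one_add (pow_nonneg (Set.mem_Ici.1 hx) k)
      (pow_nonneg (Set.mem_Ici.1 hy) k) (pow_lt_pow_left₀ hxy hx hk.ne')
    simp only [hf, mul_div_assoc]
    exact add_lt_add_of_le_of_lt (mul_le_mul_of_nonneg_left h₁.le hA)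
      (mul_lt_mul_of_pos_left h₂ hC)
  have hf0 : f 0 = 0 := by simp [hf, hk.ne']
  obtain ⟨d, hd⟩ : ∃ d, d = A + C - m := ⟨_, rfl⟩
  have hd0 : 0 < d := by linarith
  set S : ℝ := 1 + m / d with hS
  have hS1 : 1 ≤ S := le_add_of_nonneg_right (by positivity)
  have hfS : m ≤ f S := by
    have h₁ : S / (1 + S) ≤ S ^ k / (1 + S ^ k) :=
      strictMonoOn_div_one_add.monotoneOn (Set.mem_Ici.2 (by positivity))
        (Set.mem_Ici.2 (by positivity)) (le_self_pow₀ hS1 hk.ne')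
    have h₂ : m ≤ (A + C) * (S / (1 + S)) := by
      have hdS : d * S = d + m := by rw [hS]; field_simp
      rw [← mul_div_assoc, le_div_iff₀ (by positivity)]
      nlinarith
    have h₃ := mul_le_mul_of_nonneg_left h₁ hC.le
    simp only [hf, mul_div_assoc]
    linarith
  have hcont : ContinuousOn f (Set.Icc 0 S) := by
    intro x hx
    have hx0 : 0 ≤ x := hx.1
    have h₁ : 1 + x ≠ 0 := by positivity
    have h₂ : 1 + x ^ k ≠ 0 := by positivity
    apply ContinuousAt.continuousWithinAt
    fun_prop (disch := assumption)
  obtain ⟨s, hs, hfs⟩ := intermediate_value_Icc (by positivity) hcont ⟨hf0.trans_le hm.le, hfS⟩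
  have hs0 : 0 < s := by
    refine hs.1.lt_of_ne ?_
    rintro rfl
    linarith
  refine ⟨s, ⟨hs0, hfs.symm⟩, ?_⟩
  rintro y ⟨hy, hmy⟩
  exact hmono.injOn (Set.mem_Ici.2 hy.le) (Set.mem_Ici.2 hs0.le) (hmy.symm.trans hfs.symm)

theorem eq_mul_div_one_add_add_iff {x t b i : ℝ} (hx : 0 < x) (ht : 0 < t) (hib : i < b) :
    i = b * t / (1 + x + t) ↔ t = (1 + x) * i / (b - i) := by
  have hbi : b - i ≠ 0 := (sub_pos.2 hib).ne'
  rw [eq_div_iff (by positivity), eq_div_iff hbi]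
  constructor <;> intro h <;> linarith

theorem mul_div_one_add_add_eq {x t b i k : ℝ} (hx : 0 < x) (ht : 0 < t) (hib : i < b)
    (h : t = (1 + x) * i / (b - i)) :
    b * k * x / (1 + x + t) = k * (b - i) * x / (1 + x) := by
  rw [eq_div_iff (sub_pos.2 hib).ne'] at h
  rw [div_eq_div_iff (by positivity) (by positivity)]
  linear_combination (-k * x) * h


/-- for interior indices, the intersection system of L(0,0) and L(a,b)
has a unique positive solution (s,t), with t = (1+s^k)·i₂/(b−i₂) where s is the
unique positive solution of the reduced equation. -/
theorem stmt_6 (k : ℕ) (hk : 0 < k) (a b i₁ i₂ : ℤ)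
    (ha : 0 ≤ a) (hb : 1 ≤ b) (hi₂ : 0 < i₂ ∧ i₂ < b)
    (hi₁ : 0 < i₁ ∧ (i₁ : ℝ) < (a : ℝ) + k * ((b : ℝ) - i₂)) :
    (∃! p : ℝ × ℝ, 0 < p.1 ∧ 0 < p.2 ∧
        (i₁ : ℝ) = a * p.1 / (1 + p.1) + b * k * p.1 ^ k / (1 + p.1 ^ k + p.2) ∧
        (i₂ : ℝ) = b * p.2 / (1 + p.1 ^ k + p.2))
    ∧ (∃! s : ℝ, 0 < s ∧
        (i₁ : ℝ) = a * s / (1 + s) + k * ((b : ℝ) - i₂) * s ^ k / (1 + s ^ k))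
    ∧ (∀ p : ℝ × ℝ, 0 < p.1 → 0 < p.2 →
        (i₁ : ℝ) = a * p.1 / (1 + p.1) + b * k * p.1 ^ k / (1 + p.1 ^ k + p.2) →
        (i₂ : ℝ) = b * p.2 / (1 + p.1 ^ k + p.2) →
        p.2 = (1 + p.1 ^ k) * (i₂ : ℝ) / ((b : ℝ) - i₂) ∧
        (i₁ : ℝ) = a * p.1 / (1 + p.1)
          + k * ((b : ℝ) - i₂) * p.1 ^ k / (1 + p.1 ^ k)) := by

  obtain ⟨hi₂, hib⟩ := hi₂
  obtain ⟨hi₁, him⟩ := hi₁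
  replace ha : (0 : ℝ) ≤ a := by exact_mod_cast ha
  replace hi₂ : (0 : ℝ) < i₂ := by exact_mod_cast hi₂
  replace hib : (i₂ : ℝ) < b := by exact_mod_cast hib
  replace hi₁ : (0 : ℝ) < i₁ := by exact_mod_cast hi₁
  have hbi : (0 : ℝ) < b - i₂ := sub_pos.2 hib
  have hreduced := existsUnique_pos_eq_add_div_one_add hk ha
    (mul_pos (Nat.cast_pos.2 hk) hbi) hi₁ him
  have hsolution : ∀ p : ℝ × ℝ, 0 < p.1 → 0 < p.2 →
      (i₁ : ℝ) = a * p.1 / (1 + p.1) + b * k * p.1 ^ k / (1 + p.1 ^ k + p.2) →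
      (i₂ : ℝ) = b * p.2 / (1 + p.1 ^ k + p.2) →
      p.2 = (1 + p.1 ^ k) * (i₂ : ℝ) / ((b : ℝ) - i₂) ∧
      (i₁ : ℝ) = a * p.1 / (1 + p.1)
        + k * ((b : ℝ) - i₂) * p.1 ^ k / (1 + p.1 ^ k) := by
    intro p hs ht h₁ h₂
    have h := (eq_mul_div_one_add_add_iff (pow_pos hs k) ht hib).1 h₂
    exact ⟨h, by rw [← mul_div_one_add_add_eq (pow_pos hs k) ht hib h]; exact h₁⟩
  refine ⟨?_, hreduced, hsolution⟩
  obtain ⟨s, ⟨hs, hsi⟩, huniq⟩ := hreduced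
  obtain ⟨t, ht⟩ : ∃ t, t = (1 + s ^ k) * (i₂ : ℝ) / ((b : ℝ) - i₂) := ⟨_, rfl⟩
  have ht0 : 0 < t := by rw [ht]; positivity
  refine ⟨(s, t), ⟨hs, ht0, ?_, (eq_mul_div_one_add_add_iff (pow_pos hs k) ht0 hib).2 ht⟩, ?_⟩
  · rw [mul_div_one_add_add_eq (pow_pos hs k) ht0 hib ht]
    exact hsi
  · rintro ⟨s', t'⟩ ⟨hs', ht', h₁, h₂⟩
    obtain ⟨hts, hred⟩ := hsolution (s', t') hs' ht' h₁ h₂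
    obtain rfl : s' = s := huniq s' ⟨hs', hred⟩
    exact Prod.ext rfl (hts.trans ht.symm)
end

section
/- Let k be a positive integer and let a, i₁ be integers with a ≥ 1 and 0 < i₁ < a. Define F : (0,∞)² → ℝ² by F(s,t) = ( 2s/(1+s) + 2k·s^k/(1+s^k+t), 2t/(1+s^k+t) ). Set r = i₁^k/(i₁^k + (a−i₁)^k). Then the image under F of the set { (s,t) ∈ (0,∞)² : a·s/(1+s) = i₁ } equals the open line segment { (x¹,x²) ∈ ℝ² : 0 < x² < 2 and x¹ + k·r·x² = 2i₁/a + 2k·r }. -/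
/-- The ratio `i ^ k / (i ^ k + b ^ k)` in terms of the odds `i / b`. -/
lemma pow_div_pow_add_pow {i b : ℝ} (hi : 0 < i) (hb : 0 < b) (k : ℕ) :
    i ^ k / (i ^ k + b ^ k) = (i / b) ^ k / (1 + (i / b) ^ k) := by
  have h1 := pow_pos hi k
  have h2 := pow_pos hb k
  rw [div_pow]
  field_simp
  ring

lemma two_mul_odds_div {a i : ℝ} (hb : a - i ≠ 0) (ha : a ≠ 0) :
    2 * (i / (a - i)) / (1 + i / (a - i)) = 2 * i / a := by
  have h : 1 + i / (a - i) = a / (a - i) := by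
    field_simp
    ring
  rw [h]
  field_simp

lemma mul_div_one_add_eq_iff {a i s : ℝ} (hs : 0 < s) (hb : a - i ≠ 0) :
    a * s / (1 + s) = i ↔ s = i / (a - i) := by
  rw [div_eq_iff (by positivity), eq_div_iff hb]
  constructor <;> intro h <;> linarith

/-- The curve `t ↦ (c + 2 m u / (1 + u + t), 2 t / (1 + u + t))`, `t > 0`, traces out an open
line segment. -/
lemma exists_pos_fiber_iff (c m : ℝ) {u x y : ℝ} (hu : 0 < u) :
    (∃ t : ℝ, 0 < t ∧ c + 2 * m * u / (1 + u + t) = x ∧ 2 * t / (1 + u + t) = y) ↔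
      0 < y ∧ y < 2 ∧ x + m * (u / (1 + u)) * y = c + 2 * m * (u / (1 + u)) := by
  constructor
  · rintro ⟨t, ht, rfl, rfl⟩
    refine ⟨by positivity, ?_, ?_⟩
    · rw [div_lt_iff₀ (by positivity)]
      linarith
    · field_simp
      ring
  · rintro ⟨hy, hy2, h⟩
    have h2 : 0 < 2 - y := by linarith
    have hd : 1 + u + (1 + u) * y / (2 - y) = 2 * (1 + u) / (2 - y) := by
      field_simp
      ring
    refine ⟨(1 + u) * y / (2 - y), by positivity, ?_, ?_⟩
    · rw [hd, eq_sub_of_add_eq h]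
      field_simp
      ring
    · rw [hd]
      field_simp

/-- the image under the moment-coordinate map F of the set
{a·s/(1+s) = i₁} is the stated open line segment in the moment polytope. -/
theorem stmt_7 (k : ℕ) (hk : 0 < k) (a i₁ : ℤ) (ha : 1 ≤ a)
    (hi₁ : 0 < i₁ ∧ i₁ < a) :
    (fun p : ℝ × ℝ =>
        ((2 * p.1 / (1 + p.1) + 2 * k * p.1 ^ k / (1 + p.1 ^ k + p.2),
          2 * p.2 / (1 + p.1 ^ k + p.2)) : ℝ × ℝ)) ''
      {p : ℝ × ℝ | 0 < p.1 ∧ 0 < p.2 ∧ (a : ℝ) * p.1 / (1 + p.1) = (i₁ : ℝ)}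
    = {x : ℝ × ℝ | 0 < x.2 ∧ x.2 < 2 ∧
        x.1 + k * ((i₁ : ℝ) ^ k / ((i₁ : ℝ) ^ k + ((a : ℝ) - i₁) ^ k)) * x.2
          = 2 * (i₁ : ℝ) / a
            + 2 * k * ((i₁ : ℝ) ^ k / ((i₁ : ℝ) ^ k + ((a : ℝ) - i₁) ^ k))} := by
  obtain ⟨hi, hia⟩ := hi₁
  have hi' : (0 : ℝ) < i₁ := by exact_mod_cast hi
  have hb : (0 : ℝ) < (a : ℝ) - i₁ := by
    have : (i₁ : ℝ) < a := by exact_mod_cast hia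
    linarith
  have ha' : (0 : ℝ) < a := by linarith
  have hs : (0 : ℝ) < (i₁ : ℝ) / ((a : ℝ) - i₁) := div_pos hi' hb
  have hr := pow_div_pow_add_pow hi' hb k
  have hc := two_mul_odds_div hb.ne' ha'.ne'
  rw [hr]
  ext ⟨x, y⟩
  simp only [Set.mem_image, Set.mem_ofPred_eq, Prod.mk.injEq, Prod.exists]
  rw [← hc, ← exists_pos_fiber_iff _ k (pow_pos hs k)]
  constructor
  · rintro ⟨s, t, ⟨hs0, ht, hst⟩, hx, hy⟩
    obtain rfl := (mul_div_one_add_eq_iff hs0 hb.ne').1 hst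
    exact ⟨t, ht, hx, hy⟩
  · rintro ⟨t, ht, hx, hy⟩
    exact ⟨_, t, ⟨hs, ht, (mul_div_one_add_eq_iff hs hb.ne').2 rfl⟩, hx, hy⟩
end

section
/- Let k be a positive integer and let a, b, i₁, i₂ be integers with a ≥ 0, b ≥ 0, 0 ≤ i₂ ≤ b, and 0 ≤ i₁ ≤ a + k(b−i₂). Then the function f_I : ℝ² → ℝ defined by f_I(x₁,x₂) = (a/2)·log(1+e^{2x₁}) + (b/2)·log(1+e^{2k x₁}+e^{2x₂}) − i₁·x₁ − i₂·x₂ is bounded below on ℝ². -/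
/-- for indices in the admissible range, the potential f_I is
bounded below on ℝ². -/
theorem stmt_8 (k : ℕ) (hk : 0 < k) (a b i₁ i₂ : ℤ)
    (ha : 0 ≤ a) (hb : 0 ≤ b) (hi₂ : 0 ≤ i₂ ∧ i₂ ≤ b)
    (hi₁ : 0 ≤ i₁ ∧ (i₁ : ℝ) ≤ (a : ℝ) + k * ((b : ℝ) - i₂)) :
    BddBelow (Set.range (fun x : ℝ × ℝ =>
      ((a : ℝ) / 2) * Real.log (1 + Real.exp (2 * x.1))
        + ((b : ℝ) / 2) * Real.log (1 + Real.exp (2 * k * x.1) + Real.exp (2 * x.2))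
        - (i₁ : ℝ) * x.1 - (i₂ : ℝ) * x.2)) := by
  obtain ⟨hi₂0, hi₂b⟩ := hi₂
  obtain ⟨hi₁0, hi₁b⟩ := hi₁
  have ha' : (0 : ℝ) ≤ a := by exact_mod_cast ha
  have hi₁0' : (0 : ℝ) ≤ i₁ := by exact_mod_cast hi₁0
  have hi₂0' : (0 : ℝ) ≤ i₂ := by exact_mod_cast hi₂0
  have hi₂b' : (0 : ℝ) ≤ (b : ℝ) - i₂ := sub_nonneg.mpr (by exact_mod_cast hi₂b)
  refine ⟨0, ?_⟩
  rintro _ ⟨⟨x, y⟩, rfl⟩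
  dsimp only
  have hx := Real.exp_pos (2 * x)
  have hkx := Real.exp_pos (2 * k * x)
  have hy := Real.exp_pos (2 * y)
  set A := Real.log (1 + Real.exp (2 * x))
  set B := Real.log (1 + Real.exp (2 * k * x) + Real.exp (2 * y))
  have hA0 : 0 ≤ A := Real.log_nonneg (by linarith)
  have hAx : 2 * x ≤ A := (Real.le_log_iff_exp_le (by positivity)).2 (by linarith)
  have hB0 : 0 ≤ B := Real.log_nonneg (by linarith)
  have hBx : 2 * k * x ≤ B := (Real.le_log_iff_exp_le (by positivity)).2 (by linarith)
  have hBy : 2 * y ≤ B := (Real.le_log_iff_exp_le (by positivity)).2 (by linarith)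
  have h₂ := mul_le_mul_of_nonneg_left hBy hi₂0'
  rcases le_total 0 x with h | h
  · have h₁ := mul_le_mul_of_nonneg_left hAx ha'
    have h₃ := mul_le_mul_of_nonneg_left hBx hi₂b'
    have h₄ := mul_le_mul_of_nonneg_right hi₁b h
    linarith
  · have h₁ := mul_nonneg ha' hA0
    have h₃ := mul_nonneg hi₂b' hB0
    have h₄ := mul_nonpos_of_nonneg_of_nonpos hi₁0' h
    linarith
end

section
/- Let k be an integer with k ≥ 2. Then the polynomial equation (k−1)·s^k + k·s^{k−1} − 1 = 0 has exactly one solution s₀ in (0,∞), and this solution satisfies 0 < s₀ < 1. Equivalently, the equation −s/(1+s) + k·s^k/(1+s^k) = 0 has exactly one solution in (0,∞). -/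
/-- For `k ≥ 2`, the polynomial `(k - 1) s ^ k + k s ^ (k - 1) - 1` is strictly increasing on
the nonnegative reals. -/
lemma strictMonoOn_sub_one_mul_pow_add (k : ℕ) (hk : 2 ≤ k) :
    StrictMonoOn (fun s : ℝ => ((k : ℝ) - 1) * s ^ k + (k : ℝ) * s ^ (k - 1) - 1)
      (Set.Ici 0) := by
  intro a ha b _ hab
  have hk' : (2 : ℝ) ≤ k := by exact_mod_cast hk
  have h₁ : a ^ k < b ^ k := pow_lt_pow_left₀ hab ha (by omega)
  have h₂ : a ^ (k - 1) < b ^ (k - 1) := pow_lt_pow_left₀ hab ha (by omega)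
  have h₃ := mul_lt_mul_of_pos_left h₁ (by linarith : (0 : ℝ) < k - 1)
  have h₄ := mul_lt_mul_of_pos_left h₂ (by linarith : (0 : ℝ) < k)
  dsimp only
  linarith

/-- On the positive reals, the rational equation is equivalent to the polynomial one. -/
lemma neg_div_add_mul_pow_div_eq_zero_iff {k : ℕ} (hk : k ≠ 0) {s : ℝ} (hs : 0 < s) :
    -s / (1 + s) + (k : ℝ) * s ^ k / (1 + s ^ k) = 0 ↔
      ((k : ℝ) - 1) * s ^ k + (k : ℝ) * s ^ (k - 1) - 1 = 0 := by
  have h₁ : 1 + s ≠ 0 := by positivity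
  have h₂ : 1 + s ^ k ≠ 0 := by positivity
  have hpow : s ^ k = s * s ^ (k - 1) := (mul_pow_sub_one hk s).symm
  have key : -s * (1 + s ^ k) + (1 + s) * ((k : ℝ) * s ^ k) =
      s * (((k : ℝ) - 1) * s ^ k + (k : ℝ) * s ^ (k - 1) - 1) := by
    rw [hpow]
    ring
  rw [div_add_div _ _ h₁ h₂, key, div_eq_zero_iff, or_iff_left (mul_ne_zero h₁ h₂),
    mul_eq_zero, or_iff_right hs.ne']

/-- for k ≥ 2, (k−1)s^k + k·s^{k−1} − 1 = 0 has exactly one positive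
solution, which lies in (0,1); equivalently −s/(1+s) + k·s^k/(1+s^k) = 0 has
exactly one solution in (0,∞). -/
theorem stmt_11 (k : ℕ) (hk : 2 ≤ k) :
    (∃! s : ℝ, 0 < s ∧ ((k : ℝ) - 1) * s ^ k + (k : ℝ) * s ^ (k - 1) - 1 = 0)
    ∧ (∀ s : ℝ, 0 < s → ((k : ℝ) - 1) * s ^ k + (k : ℝ) * s ^ (k - 1) - 1 = 0 →
        s < 1)
    ∧ (∃! s : ℝ, 0 < s ∧ -s / (1 + s) + (k : ℝ) * s ^ k / (1 + s ^ k) = 0) := by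
  have hk' : (2 : ℝ) ≤ k := by exact_mod_cast hk
  have hmono := strictMonoOn_sub_one_mul_pow_add k hk
  have hcont : ContinuousOn
      (fun s : ℝ => ((k : ℝ) - 1) * s ^ k + (k : ℝ) * s ^ (k - 1) - 1) (Set.Icc 0 1) := by
    fun_prop
  have hpoly : ∃! s : ℝ,
      0 < s ∧ ((k : ℝ) - 1) * s ^ k + (k : ℝ) * s ^ (k - 1) - 1 = 0 := by
    obtain ⟨s, hs, hs₀⟩ := intermediate_value_Ioo zero_le_one hcont
      (show (0 : ℝ) ∈ Set.Ioo _ _ by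
        have h₁ : k ≠ 0 := by omega
        have h₂ : k - 1 ≠ 0 := by omega
        simp only [zero_pow h₁, zero_pow h₂, one_pow]
        constructor <;> linarith)
    exact ⟨s, ⟨hs.1, hs₀⟩, fun t ht =>
      hmono.injOn ht.1.le hs.1.le (ht.2.trans hs₀.symm)⟩
  refine ⟨hpoly, fun s hs hs₀ => ?_, ?_⟩
  · by_contra! h
    have := hmono.monotoneOn (Set.mem_Ici.2 zero_le_one) hs.le h
    simp only [one_pow] at this
    linarith
  · refine (existsUnique_congr fun s => and_congr_right fun hs => ?_).2 hpoly
    exact neg_div_add_mul_pow_div_eq_zero_iff (by omega) hs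
end

section
/- Let k be an integer with k ≥ 2 and let i₁ be an integer with 0 < i₁ < k−1. Then the equation −s/(1+s) + k·s^k/(1+s^k) = i₁ has exactly one solution s in (0,∞). -/
theorem neg_div_add_mul_pow_div_eq_iff (m : ℕ) (i : ℝ) {s : ℝ} (hs : 0 < s) :
    -s / (1 + s) + ((m + 1 : ℕ) : ℝ) * s ^ (m + 1) / (1 + s ^ (m + 1)) = i ↔
      s * ((m - i) * s ^ (m + 1) + (m + 1 - i) * s ^ m - (1 + i)) = i := by
  have h₁ : 1 + s ≠ 0 := by positivity
  have h₂ : 1 + s ^ (m + 1) ≠ 0 := by positivity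
  rw [div_add_div _ _ h₁ h₂, div_eq_iff (mul_ne_zero h₁ h₂)]
  push_cast
  constructor <;> intro h <;> linear_combination h

/-- A function `s ↦ s * (a * s ^ (m + 1) + b * s ^ m - c)` takes every positive value at most
once on the positive reals. -/
theorem eq_of_mul_sub_eq_pos {m : ℕ} {a b c d s t : ℝ} (ha : 0 < a) (hb : 0 ≤ b) (hd : 0 < d)
    (hs : 0 < s) (ht : 0 < t) (hsd : s * (a * s ^ (m + 1) + b * s ^ m - c) = d)
    (htd : t * (a * t ^ (m + 1) + b * t ^ m - c) = d) : s = t := by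
  wlog hle : s ≤ t generalizing s t
  · exact (this ht hs htd hsd (le_of_not_ge hle)).symm
  by_contra hne
  have hst : s < t := lt_of_le_of_ne hle hne
  have hpos : 0 < a * s ^ (m + 1) + b * s ^ m - c :=
    pos_of_mul_pos_right (hsd ▸ hd) hs.le
  have h₁ : a * s ^ (m + 1) < a * t ^ (m + 1) :=
    mul_lt_mul_of_pos_left (pow_lt_pow_left₀ hst hs.le m.succ_ne_zero) ha
  have h₂ : b * s ^ m ≤ b * t ^ m :=
    mul_le_mul_of_nonneg_left (pow_le_pow_left₀ hs.le hle m) hb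
  have := mul_lt_mul'' hst (show _ < a * t ^ (m + 1) + b * t ^ m - c by linarith) hs.le hpos.le
  linarith

theorem exists_pos_mul_sub_eq {m : ℕ} {i : ℝ} (hi : 0 < i) (him : i + 1 ≤ m) :
    ∃ s : ℝ, 0 < s ∧ s * ((m - i) * s ^ (m + 1) + (m + 1 - i) * s ^ m - (1 + i)) = i := by
  set f : ℝ → ℝ := fun s ↦ s * ((m - i) * s ^ (m + 1) + (m + 1 - i) * s ^ m - (1 + i)) with hf
  have hM : (0 : ℝ) ≤ m + 1 := by positivity
  have hpow : (m + 1 : ℝ) ≤ (m + 1 : ℝ) ^ (m + 1) :=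
    le_self_pow₀ (by linarith) m.succ_ne_zero
  have hpow' : (0 : ℝ) ≤ (m + 1 - i) * (m + 1 : ℝ) ^ m :=
    mul_nonneg (by linarith) (by positivity)
  have htop : i ≤ f (m + 1) := by
    have h₁ : (1 : ℝ) ≤ (m - i) * (m + 1 : ℝ) ^ (m + 1) + (m + 1 - i) * (m + 1 : ℝ) ^ m
        - (1 + i) := by
      nlinarith
    have := mul_le_mul_of_nonneg_left h₁ hM
    simp only [hf]
    linarith
  have hcont : ContinuousOn f (Set.Icc 0 (m + 1)) := by fun_prop
  obtain ⟨s, ⟨hs, -⟩, hsi⟩ :=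
    intermediate_value_Icc hM hcont ⟨by simpa [hf] using hi.le, htop⟩
  refine ⟨s, lt_of_le_of_ne hs ?_, hsi⟩
  rintro rfl
  simp [hf] at hsi
  exact hi.ne hsi

/-- for k ≥ 2 and 0 < i₁ < k−1, the equation
−s/(1+s) + k·s^k/(1+s^k) = i₁ has exactly one solution in (0,∞). -/
theorem stmt_13 (k : ℕ) (hk : 2 ≤ k) (i₁ : ℤ) (hi₁ : 0 < i₁ ∧ i₁ < (k : ℤ) - 1) :
    ∃! s : ℝ, 0 < s ∧ -s / (1 + s) + (k : ℝ) * s ^ k / (1 + s ^ k) = (i₁ : ℝ) := by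
  obtain ⟨m, rfl⟩ : ∃ m, k = m + 1 := ⟨k - 1, by omega⟩
  have hi : (0 : ℝ) < i₁ := by exact_mod_cast hi₁.1
  have him : (i₁ : ℝ) + 1 ≤ m := by
    have : i₁ + 1 ≤ (m : ℤ) := by have := hi₁.2; omega
    exact_mod_cast this
  obtain ⟨s, hs, hsi⟩ := exists_pos_mul_sub_eq hi him
  refine ⟨s, ⟨hs, (neg_div_add_mul_pow_div_eq_iff m i₁ hs).2 hsi⟩, ?_⟩
  rintro t ⟨ht, hti⟩
  exact eq_of_mul_sub_eq_pos (by linarith) (by linarith) hi ht hs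
    ((neg_div_add_mul_pow_div_eq_iff m i₁ ht).1 hti) hsi
end
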